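/- Reduction of Birkhoff sums to special Birkhoff sums. Let T be an interval exchange transformation on d ≥ 2 intervals with no connections, let φ : I(T) → ℝ be a bounded function, let N ≥ 1 and let x ∈ I(T) be such that T^j(x) is defined for 0 ≤ j < N. Let y be the point of the finite orbit {T^j(x) : 0 ≤ j < N} closest to the left endpoint 0 of I(T), and let k be the largest integer such that y ∈ I(n_k). Then |Σ_{j=0}^{N−1} φ(T^j(x))| ≤ Σ_{l=0}^{k} ‖B(n_l, n_{l+1})‖ · ‖S(0, n_l)φ‖_{L∞(I(n_l))}. -/

import Mathlib

open scoped Classical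
open Set Filter MeasureTheory

namespace IETPaper

/-- An interval exchange transformation on `d` intervals: positive length data indexed by
an alphabet of `d` letters (here `Fin d`), together with irreducible combinatorial data
given by a pair of bijections (`pit` = top, `pib` = bottom, with values `0,…,d-1`
corresponding to positions `1,…,d`). -/
structure IET (d : ℕ) where
  lam : Fin d → ℝ
  lam_pos : ∀ a, 0 < lam a
  pit : Fin d ≃ Fin d
  pib : Fin d ≃ Fin d
  irred : ∀ k : ℕ, 0 < k → k < d →
    Finset.univ.filter (fun a => (pit a : ℕ) < k) ≠
      Finset.univ.filter (fun a => (pib a : ℕ) < k)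

namespace IET

variable {d : ℕ}

/-- Total length of the interval `I(T)`. -/
noncomputable def len (T : IET d) : ℝ := ∑ a, T.lam a

/-- The singularity data: `u k = Σ_{π_t(α) ≤ k} λ_α` (0-indexed: sum of the lengths of the
first `k` top intervals). -/
noncomputable def upt (T : IET d) (k : ℕ) : ℝ :=
  ∑ a ∈ Finset.univ.filter (fun a => (T.pit a : ℕ) < k), T.lam a

/-- `v k`: the singularities of `T⁻¹`. -/
noncomputable def vpt (T : IET d) (k : ℕ) : ℝ :=
  ∑ a ∈ Finset.univ.filter (fun a => (T.pib a : ℕ) < k), T.lam a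

/-- Left endpoint of the top interval `I_α^t(T)`. -/
noncomputable def lept (T : IET d) (a : Fin d) : ℝ := T.upt (T.pit a)

/-- Right endpoint of the top interval `I_α^t(T)`. -/
noncomputable def rept (T : IET d) (a : Fin d) : ℝ := T.upt (T.pit a) + T.lam a

/-- Left endpoint of the bottom interval `I_α^b(T)`. -/
noncomputable def lepb (T : IET d) (a : Fin d) : ℝ := T.vpt (T.pib a)

/-- Right endpoint of the bottom interval `I_α^b(T)`. -/
noncomputable def repb (T : IET d) (a : Fin d) : ℝ := T.vpt (T.pib a) + T.lam a

/-- The top interval `I_α^t(T)` (half-open). -/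
def topI (T : IET d) (a : Fin d) : Set ℝ := Set.Ico (T.lept a) (T.rept a)

/-- The bottom interval `I_α^b(T)` (half-open). -/
def botI (T : IET d) (a : Fin d) : Set ℝ := Set.Ico (T.lepb a) (T.repb a)

/-- The interval `I(T) = [0, len T)`. -/
def domain (T : IET d) : Set ℝ := Set.Ico 0 T.len

/-- The interval exchange map: on each `I_α^t(T)` it is the translation taking `I_α^t(T)`
onto `I_α^b(T)` (and the identity outside the top intervals, as junk value). -/
noncomputable def toFun (T : IET d) (x : ℝ) : ℝ :=
  if h : ∃ a : Fin d, x ∈ T.topI a then x - T.lept h.choose + T.lepb h.choose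
  else x

/-- `T` has a connection: a triple `(u_k, v_l, m)` with `0 < k, l < d`, `m ≥ 0`
and `T^m (v_l) = u_k`. -/
def HasConnection (T : IET d) : Prop :=
  ∃ k l m : ℕ, 0 < k ∧ k < d ∧ 0 < l ∧ l < d ∧ T.toFun^[m] (T.vpt l) = T.upt k

def NoConnections (T : IET d) : Prop := ¬ T.HasConnection

/-- The permutation `σ` on `𝒜 × {L, R}` (here `L = false`, `R = true`) whose cycles
correspond to the marked points of the suspended translation surface. -/
noncomputable def bnext (T : IET d) (c : Fin d × Bool) : Fin d × Bool :=
  if c.2 then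
    if h : (T.pit c.1 : ℕ) + 1 < d then (T.pit.symm ⟨(T.pit c.1 : ℕ) + 1, h⟩, false)
    else (T.pib.symm ⟨d - 1, by have := c.1.pos; omega⟩, true)
  else
    if _h : 0 < (T.pib c.1 : ℕ) then
      (T.pib.symm ⟨(T.pib c.1 : ℕ) - 1, by have := (T.pib c.1).isLt; omega⟩, true)
    else (T.pit.symm ⟨0, c.1.pos⟩, false)

/-- The cycle (orbit under `σ`) of an element of `𝒜 × {L, R}`. -/
noncomputable def cycleOf (T : IET d) (c : Fin d × Bool) : Finset (Fin d × Bool) :=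
  Finset.univ.filter (fun c' => ∃ n : ℕ, T.bnext^[n] c = c')

/-- Number of cycles of `σ`, i.e. number of marked points `s`. -/
noncomputable def numCycles (T : IET d) : ℕ :=
  Set.ncard {O : Set (Fin d × Bool) | ∃ c, O = {c' | ∃ n : ℕ, T.bnext^[n] c = c'}}

/-- The antisymmetric matrix `Ω(π)`. -/
noncomputable def Omega (T : IET d) : Matrix (Fin d) (Fin d) ℝ :=
  fun a b =>
    if (T.pit a : ℕ) < (T.pit b : ℕ) ∧ (T.pib b : ℕ) < (T.pib a : ℕ) then 1
    else if (T.pit b : ℕ) < (T.pit a : ℕ) ∧ (T.pib a : ℕ) < (T.pib b : ℕ) then -1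
    else 0

/-- The genus `g`: half the rank of `Ω(π)`. -/
noncomputable def genus (T : IET d) : ℕ := T.Omega.rank / 2

end IET

/-- Sign `ε(c)`: `+1` on right endpoints, `-1` on left endpoints. -/
noncomputable def bsign {d : ℕ} (c : Fin d × Bool) : ℝ := if c.2 then 1 else -1

/-- The component of the boundary operator corresponding to the cycle of `c`, applied to
an assignment `f` of (one-sided limit) values to the elements of `𝒜 × {L, R}`. -/
noncomputable def cycleSum {d : ℕ} (T : IET d) (f : Fin d × Bool → ℝ) (c : Fin d × Bool) : ℝ :=
  ∑ c' ∈ T.cycleOf c, bsign c' * f c'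

/-- `∂ f = 0` : all cycle components of the boundary operator vanish. -/
def BoundaryZero {d : ℕ} (T : IET d) (f : Fin d × Bool → ℝ) : Prop :=
  ∀ c, cycleSum T f c = 0

/-- First return time of `x` to `J` under `f` (junk if it does not return). -/
noncomputable def firstReturnTime (f : ℝ → ℝ) (J : Set ℝ) (x : ℝ) : ℕ :=
  sInf {n : ℕ | 0 < n ∧ f^[n] x ∈ J}

/-- First return map of `f` to `J`. -/
noncomputable def firstReturnMap (f : ℝ → ℝ) (J : Set ℝ) (x : ℝ) : ℝ :=
  f^[firstReturnTime f J x] x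

/-- The Rauzy–Veech tower over an i.e.t. `T` with no connections: the sequence `T(n)` of
i.e.t.'s produced by the Rauzy–Veech algorithm (`T(n+1)` is the first-return map of `T(n)`
to `I(n+1) = [0, max (u_{d-1}(T(n)), v_{d-1}(T(n))))`), together with the Kontsevich–Zorich
cocycle matrices `B(m,n)` with their defining properties. -/
structure RVTower (d : ℕ) (T : IET d) where
  iet : ℕ → IET d
  iet_zero : iet 0 = T
  len_succ : ∀ n, (iet (n+1)).len = max ((iet n).upt (d-1)) ((iet n).vpt (d-1))
  step : ∀ n, ∃ F : Finset ℝ, ∀ x ∈ (iet (n+1)).domain, x ∉ F →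
    (iet (n+1)).toFun x = firstReturnMap (iet n).toFun (iet (n+1)).domain x
  B : ℕ → ℕ → Matrix (Fin d) (Fin d) ℕ
  B_self : ∀ m, B m m = 1
  B_cocycle : ∀ m n p, m ≤ n → n ≤ p → B m p = B n p * B m n
  B_lam : ∀ m n, m ≤ n → ∀ b, (iet m).lam b = ∑ a, (B m n a b : ℝ) * (iet n).lam a
  B_visits : ∀ m n, m ≤ n → ∀ a b : Fin d, ∃ x ∈ (iet n).topI a,
    (B m n a b : ℕ) = Nat.card {j : ℕ |
      j < firstReturnTime (iet m).toFun (iet n).domain x ∧ (iet m).toFun^[j] x ∈ (iet m).topI b}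

namespace RVTower

variable {d : ℕ} {T : IET d}

/-- The accelerated (Yoccoz) times: `n_0 = 0` and `n_{k+1}` is the smallest `n` such that
all entries of `B(n_k, n)` are positive. -/
noncomputable def acc (tw : RVTower d T) : ℕ → ℕ
  | 0 => 0
  | k + 1 => sInf {n : ℕ | ∀ a b : Fin d, 0 < tw.B (RVTower.acc tw k) n a b}

end RVTower

/-- The norm of a (Kontsevich–Zorich) matrix: sum of (absolute values of) its entries. -/
noncomputable def mnorm {d : ℕ} (M : Matrix (Fin d) (Fin d) ℕ) : ℝ := ∑ a, ∑ b, (M a b : ℝ)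

/-- Norm of a vector in `Γ(T(n)) ≅ ℝ^𝒜`. -/
noncomputable def vnorm {d : ℕ} (v : Fin d → ℝ) : ℝ := ∑ a, |v a|

/-- Action of a Kontsevich–Zorich matrix on `Γ ≅ ℝ^𝒜` (the special Birkhoff sum operator
on piecewise constant functions). -/
noncomputable def bAct {d : ℕ} (M : Matrix (Fin d) (Fin d) ℕ) (v : Fin d → ℝ) : Fin d → ℝ :=
  fun a => ∑ b, (M a b : ℝ) * v b

/-- The special Birkhoff sum `S(m,n)φ` evaluated at `x ∈ I(n)`. -/
noncomputable def sBS {d : ℕ} {T : IET d} (tw : RVTower d T) (m n : ℕ) (φ : ℝ → ℝ) (x : ℝ) :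
    ℝ :=
  ∑ j ∈ Finset.range (firstReturnTime (tw.iet m).toFun (tw.iet n).domain x),
    φ ((tw.iet m).toFun^[j] x)

/-- `Γ₀(T(n))`: vectors (piecewise constant functions) with zero average. -/
def Gamma0 {d : ℕ} {T : IET d} (tw : RVTower d T) (n : ℕ) : Set (Fin d → ℝ) :=
  {v | ∑ a, v a * (tw.iet n).lam a = 0}

/-- Condition (a) of the Diophantine class `DC(η, θ, σ)`. -/
def CondA {d : ℕ} {T : IET d} (tw : RVTower d T) (η : ℝ) : Prop :=
  ∀ ε > (0:ℝ), ∃ C > (0:ℝ), ∀ k : ℕ,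
    mnorm (tw.B (tw.acc k) (tw.acc (k+1))) ≤ C * mnorm (tw.B 0 (tw.acc k)) ^ (η + ε)

/-- Condition (b) of the Diophantine class `DC(η, θ, σ)`. -/
def CondB {d : ℕ} {T : IET d} (tw : RVTower d T) (θ : ℝ) : Prop :=
  ∃ C > (0:ℝ), ∀ k : ℕ, ∀ v ∈ Gamma0 tw 0,
    vnorm (bAct (tw.B 0 (tw.acc k)) v) ≤ C * mnorm (tw.B 0 (tw.acc k)) ^ (1 - θ) * vnorm v

/-- The stable space `Γ_s(T(n_p))` (as a set). -/
def stableSet {d : ℕ} {T : IET d} (tw : RVTower d T) (σ : ℝ) (p : ℕ) : Set (Fin d → ℝ) :=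
  {v | ∃ C : ℝ, ∀ q, p ≤ q →
    vnorm (bAct (tw.B (tw.acc p) (tw.acc q)) v) ≤ C * mnorm (tw.B (tw.acc p) (tw.acc q)) ^ (-σ)}

/-- The quotient norm on `Γ(T(n_p))/Γ_s(T(n_p))`. -/
noncomputable def qnorm {d : ℕ} {T : IET d} (tw : RVTower d T) (σ : ℝ) (p : ℕ)
    (v : Fin d → ℝ) : ℝ :=
  sInf {r : ℝ | ∃ χ ∈ stableSet tw σ p, r = vnorm (v - χ)}

/-- Condition (c) of the Diophantine class `DC(η, θ, σ)`. -/
def CondC {d : ℕ} {T : IET d} (tw : RVTower d T) (σ : ℝ) : Prop :=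
  (∀ k l, k ≤ l → ∀ v ∈ stableSet tw σ k,
    bAct (tw.B (tw.acc k) (tw.acc l)) v ∈ stableSet tw σ l) ∧
  (∀ ε > (0:ℝ), ∃ C > (0:ℝ), ∀ k l, k ≤ l → ∀ v ∈ stableSet tw σ k,
    vnorm (bAct (tw.B (tw.acc k) (tw.acc l)) v) ≤ C * mnorm (tw.B 0 (tw.acc l)) ^ ε * vnorm v) ∧
  (∀ ε > (0:ℝ), ∃ C > (0:ℝ), ∀ k l, k ≤ l → ∀ v : Fin d → ℝ,
    qnorm tw σ l (bAct (tw.B (tw.acc k) (tw.acc l)) v) ≤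
      C * mnorm (tw.B 0 (tw.acc l)) ^ ε * qnorm tw σ k v)

/-- Dimension `μ` of the stable space `Γ_s(T)`. -/
noncomputable def stableDim {d : ℕ} {T : IET d} (tw : RVTower d T) (σ : ℝ) : ℕ :=
  Module.finrank ℝ (Submodule.span ℝ (stableSet tw σ 0))

/-- Condition (d) of the Diophantine class `DC(η, θ, σ)`. -/
def CondD {d : ℕ} {T : IET d} (tw : RVTower d T) (σ : ℝ) : Prop :=
  stableDim tw σ < T.genus →
    ∀ v : Fin d → ℝ, v ∉ Submodule.span ℝ (stableSet tw σ 0) →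
      ∃ c > (0:ℝ), ∃ᶠ n in atTop, c ≤ vnorm (bAct (tw.B 0 n) v)

/-- The Diophantine class `DC(η, θ, σ)`. -/
def DC {d : ℕ} {T : IET d} (tw : RVTower d T) (η θ σ : ℝ) : Prop :=
  CondA tw η ∧ CondB tw θ ∧ CondC tw σ ∧ CondD tw σ

/-- One-sided limit values at the endpoints of the continuity intervals of the `i`-th
derivative of a family `Φ` (where `Φ a` represents the restriction of the function to
`cl (I_a^t(T))`). -/
noncomputable def sideVal {d : ℕ} (T : IET d) (Φ : Fin d → ℝ → ℝ) (i : ℕ)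
    (c : Fin d × Bool) : ℝ :=
  iteratedDerivWithin i (Φ c.1) (Set.Icc (T.lept c.1) (T.rept c.1))
    (if c.2 then T.rept c.1 else T.lept c.1)

/-- Membership in `C^{r+BV}(⊔_α I_α^t(T))`: `C^r` on each closed continuity interval, with
`r`-th derivative of bounded variation. -/
def MemCrBV {d : ℕ} (T : IET d) (r : ℕ) (Φ : Fin d → ℝ → ℝ) : Prop :=
  (∀ a, ContDiffOn ℝ r (Φ a) (Set.Icc (T.lept a) (T.rept a))) ∧
  (∀ a, BoundedVariationOn
    (iteratedDerivWithin r (Φ a) (Set.Icc (T.lept a) (T.rept a)))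
    (Set.Icc (T.lept a) (T.rept a)))

/-- Membership in `C^{r+BV}_∂(⊔_α I_α^t(T))`: moreover `∂ D^i Φ = 0` for `0 ≤ i < r`. -/
def MemCrBVD {d : ℕ} (T : IET d) (r : ℕ) (Φ : Fin d → ℝ → ℝ) : Prop :=
  MemCrBV T r Φ ∧ ∀ i < r, BoundaryZero T (sideVal T Φ i)

/-- Sup of `|f|` over `s`. -/
noncomputable def supAbsOn (f : ℝ → ℝ) (s : Set ℝ) : ℝ := sSup ((fun x => |f x|) '' s)

/-- The `C^{r+BV}` norm. -/
noncomputable def crbvNorm {d : ℕ} (T : IET d) (r : ℕ) (Φ : Fin d → ℝ → ℝ) : ℝ :=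
  (∑ i ∈ Finset.range (r+1), ∑ a,
    supAbsOn (iteratedDerivWithin i (Φ a) (Set.Icc (T.lept a) (T.rept a)))
      (Set.Icc (T.lept a) (T.rept a))) +
  ∑ a, (eVariationOn (iteratedDerivWithin r (Φ a) (Set.Icc (T.lept a) (T.rept a)))
      (Set.Icc (T.lept a) (T.rept a))).toReal

/-- The `C^k` norm on `C^k(cl I(T))`. -/
noncomputable def ckNorm {d : ℕ} (T : IET d) (k : ℕ) (u : ℝ → ℝ) : ℝ :=
  ∑ i ∈ Finset.range (k+1),
    supAbsOn (iteratedDerivWithin i u (Set.Icc 0 T.len)) (Set.Icc 0 T.len)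

/-- Value of the `i`-th derivative of a piecewise polynomial (element of `Γ(r)`) at the
endpoints of the continuity intervals. -/
noncomputable def polySideVal {d : ℕ} (T : IET d) (P : Fin d → Polynomial ℝ) (i : ℕ)
    (c : Fin d × Bool) : ℝ :=
  (Polynomial.derivative^[i] (P c.1)).eval (if c.2 then T.rept c.1 else T.lept c.1)

/-- Membership in `Γ_∂(r)`: piecewise polynomial of degree `< r` with `∂ D^i = 0` for
all `0 ≤ i < r`. -/
def MemGammaDel {d : ℕ} (T : IET d) (r : ℕ) (P : Fin d → Polynomial ℝ) : Prop :=
  (∀ a, (P a).degree < (r : ℕ)) ∧ ∀ i < r, BoundaryZero T (polySideVal T P i)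

/-- Membership in `Γ_T(r)`: piecewise polynomials of degree `< r` of the form
`ψ ∘ T - ψ` with `ψ ∈ C^{r-1}(cl I(T))`. -/
def MemGammaT {d : ℕ} (T : IET d) (r : ℕ) (P : Fin d → Polynomial ℝ) : Prop :=
  (∀ a, (P a).degree < (r : ℕ)) ∧
  ∃ ψ : ℝ → ℝ, ContDiffOn ℝ (r-1 : ℕ) ψ (Set.Icc 0 T.len) ∧
    ∀ a, ∀ x ∈ T.topI a, (P a).eval x = ψ (T.toFun x) - ψ x

/-- `Γ_∂(T) = Γ(T) ∩ ker ∂` as a submodule of `Γ(T) ≅ ℝ^𝒜`. -/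
noncomputable def gammaDelVec {d : ℕ} (T : IET d) : Submodule ℝ (Fin d → ℝ) where
  carrier := {v | ∀ c, cycleSum T (fun c' => v c'.1) c = 0}
  add_mem' := by
    intro v w hv hw
    intro c
    have h1 := hv c
    have h2 := hw c
    simp only [cycleSum, Pi.add_apply, mul_add, Finset.sum_add_distrib] at *
    rw [h1, h2]; ring
  zero_mem' := by
    intro c
    simp [cycleSum]
  smul_mem' := by
    intro t v hv c
    have h1 := hv c
    simp only [cycleSum, Pi.smul_apply, smul_eq_mul] at *
    calc ∑ c' ∈ T.cycleOf c, bsign c' * (t * v c'.1)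
        = t * ∑ c' ∈ T.cycleOf c, bsign c' * v c'.1 := by
          rw [Finset.mul_sum]; exact Finset.sum_congr rfl (fun c' _ => by ring)
      _ = 0 := by rw [h1, mul_zero]

/-- The operator norm of the restriction of `B(n_p, n_q)` to `Γ₀(T(n_p))`. -/
noncomputable def restNorm {d : ℕ} {T : IET d} (tw : RVTower d T) (p q : ℕ) : ℝ :=
  sSup {r : ℝ | ∃ v ∈ Gamma0 tw (tw.acc p), vnorm v ≤ 1 ∧
    r = vnorm (bAct (tw.B (tw.acc p) (tw.acc q)) v)}

/-- The `BV` norm (total variation) of a function on `⊔_α I_α^t(T)`. -/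
noncomputable def bvNorm {d : ℕ} (T : IET d) (φ : ℝ → ℝ) : ℝ :=
  ∑ a, (eVariationOn φ (T.topI a)).toReal

/-- `g` is the map induced by `f : A → A` on `A' ⊆ A`, with return time `ρ`, and the towers
over `A'` exhaust `A`. -/
structure IsInduced {X : Type*} (f g : X → X) (A A' : Set X) (ρ : X → ℕ) : Prop where
  mapsTo_base : MapsTo f A A
  subset : A' ⊆ A
  mapsTo : MapsTo g A' A'
  pos : ∀ z ∈ A', 0 < ρ z
  map_eq : ∀ z ∈ A', f^[ρ z] z = g z
  avoid : ∀ z ∈ A', ∀ j, 0 < j → j < ρ z → f^[j] z ∉ A'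
  cover : ∀ x ∈ A, ∃ z ∈ A', ∃ j < ρ z, f^[j] z = x

namespace IsInduced

variable {X : Type*} {f g h : X → X} {A A' A'' : Set X} {ρ σ : X → ℕ}

lemma iterate_time (H : IsInduced f g A A' ρ) {z : X} (hz : z ∈ A') (K : ℕ) :
    f^[birkhoffSum g ρ K z] z = g^[K] z := by
  induction K with
  | zero => simp
  | succ K ih =>
    rw [birkhoffSum_succ, add_comm, Function.iterate_add_apply, ih,
      H.map_eq _ (H.mapsTo.iterate K hz), Function.iterate_succ_apply']

lemma birkhoffSum_induced (H : IsInduced f g A A' ρ) {M : Type*} [AddCommMonoid M] (φ : X → M)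
    {z : X} (hz : z ∈ A') (K : ℕ) :
    birkhoffSum g (fun w => birkhoffSum f φ (ρ w) w) K z =
      birkhoffSum f φ (birkhoffSum g ρ K z) z := by
  induction K with
  | zero => simp
  | succ K ih =>
    rw [birkhoffSum_succ, birkhoffSum_succ, birkhoffSum_add, ih, H.iterate_time hz]

lemma exists_time_eq (H : IsInduced f g A A' ρ) {z : X} (hz : z ∈ A') (t : ℕ) :
    ∃ K e, e < ρ (g^[K] z) ∧ t = birkhoffSum g ρ K z + e := by
  induction t with
  | zero => exact ⟨0, 0, H.pos _ hz, by simp⟩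
  | succ t ih =>
    obtain ⟨K, e, he, rfl⟩ := ih
    by_cases hlt : e + 1 < ρ (g^[K] z)
    · exact ⟨K, e + 1, hlt, by ring⟩
    · refine ⟨K + 1, 0, H.pos _ (H.mapsTo.iterate (K + 1) hz), ?_⟩
      rw [birkhoffSum_succ]
      omega

lemma time_mono (z : X) : Monotone fun K => birkhoffSum g ρ K z :=
  monotone_nat_of_le_succ fun K => by simp [birkhoffSum_succ]

lemma time_strictMono (H : IsInduced f g A A' ρ) {z : X} (hz : z ∈ A') :
    StrictMono fun K => birkhoffSum g ρ K z :=
  strictMono_nat_of_lt_succ fun K => by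
    simpa [birkhoffSum_succ] using H.pos _ (H.mapsTo.iterate K hz)

lemma exists_time_of_mem (H : IsInduced f g A A' ρ) {z : X} (hz : z ∈ A') {t : ℕ}
    (ht : f^[t] z ∈ A') : ∃ K, t = birkhoffSum g ρ K z := by
  obtain ⟨K, e, he, rfl⟩ := H.exists_time_eq hz t
  refine ⟨K, ?_⟩
  rcases Nat.eq_zero_or_pos e with rfl | he0
  · rfl
  · rw [add_comm, Function.iterate_add_apply, H.iterate_time hz] at ht
    exact absurd ht (H.avoid _ (H.mapsTo.iterate K hz) e he0 he)

lemma id_induced {f : X → X} (hf : MapsTo f A A) : IsInduced f f A A fun _ => 1 where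
  mapsTo_base := hf
  subset := subset_rfl
  mapsTo := hf
  pos _ _ := one_pos
  map_eq _ _ := rfl
  avoid _ _ j h0 h1 := by omega
  cover x hx := ⟨x, hx, 0, one_pos, rfl⟩

lemma comp (H : IsInduced f g A A' ρ) (H' : IsInduced g h A' A'' σ) :
    IsInduced f h A A'' fun z => birkhoffSum g ρ (σ z) z where
  mapsTo_base := H.mapsTo_base
  subset := H'.subset.trans H.subset
  mapsTo := H'.mapsTo
  pos z hz := by
    simpa using H.time_strictMono (H'.subset hz) (H'.pos z hz)
  map_eq z hz := by
    rw [H.iterate_time (H'.subset hz), H'.map_eq z hz]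
  avoid z hz j h0 hj hmem := by
    have hz' := H'.subset hz
    obtain ⟨K, rfl⟩ := H.exists_time_of_mem hz' (H'.subset hmem)
    rw [H.iterate_time hz'] at hmem
    have hK : K < σ z := (H.time_strictMono hz').lt_iff_lt.1 hj
    have hK0 : 0 < K := by
      rcases Nat.eq_zero_or_pos K with rfl | hK0
      · simp at h0
      · exact hK0
    exact H'.avoid z hz K hK0 hK hmem
  cover x hx := by
    obtain ⟨z, hz, j, hj, rfl⟩ := H.cover x hx
    obtain ⟨w, hw, K, hK, rfl⟩ := H'.cover z hz
    refine ⟨w, hw, j + birkhoffSum g ρ K w, ?_, ?_⟩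
    · have h1 : birkhoffSum g ρ (K + 1) w ≤ birkhoffSum g ρ (σ w) w := time_mono w hK
      rw [birkhoffSum_succ] at h1
      omega
    · rw [Function.iterate_add_apply, H.iterate_time (H'.subset hw)]

lemma firstReturnTime_eq {f g : ℝ → ℝ} {A A' : Set ℝ} {ρ : ℝ → ℕ} (H : IsInduced f g A A' ρ)
    {z : ℝ} (hz : z ∈ A') : firstReturnTime f A' z = ρ z := by
  have hmem : ρ z ∈ {n : ℕ | 0 < n ∧ f^[n] z ∈ A'} :=
    ⟨H.pos z hz, by rw [H.map_eq z hz]; exact H.mapsTo hz⟩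
  refine le_antisymm (Nat.sInf_le hmem) (not_lt.1 fun hlt => ?_)
  obtain ⟨h0, h1⟩ := Nat.sInf_mem ⟨_, hmem⟩
  exact H.avoid z hz _ h0 hlt h1

lemma abs_birkhoffSum_le {φ : X → ℝ} {M : ℝ} (hf : MapsTo f A A) (hφ : ∀ z ∈ A, |φ z| ≤ M)
    {z : X} (hz : z ∈ A) (n : ℕ) : |birkhoffSum f φ n z| ≤ n * M := by
  calc |birkhoffSum f φ n z| ≤ ∑ j ∈ Finset.range n, |φ (f^[j] z)| :=
        Finset.abs_sum_le_sum_abs _ _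
    _ ≤ ∑ _j ∈ Finset.range n, M := Finset.sum_le_sum fun j _ => hφ _ (hf.iterate j hz)
    _ = n * M := by simp

/-- Cutting a tower of height at most `R` in two, each of the two parts is bounded by half of the
height, up to one sum over the whole tower. -/
lemma abs_le_of_cut (H : IsInduced f g A A' ρ) {φ : X → ℝ} {M M' : ℝ} {R : ℕ}
    (hφ : ∀ z ∈ A, |φ z| ≤ M) (hM : 0 ≤ M) (hM' : 0 ≤ M')
    (hφ' : ∀ z ∈ A', |birkhoffSum f φ (ρ z) z| ≤ M') (hR : ∀ z ∈ A', ρ z ≤ R)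
    {z : X} (hz : z ∈ A') {i j : ℕ} (hij : i + j = ρ z) :
    |birkhoffSum f φ i z| ≤ R / 2 * M + M' ∧
      |birkhoffSum f φ j (f^[i] z)| ≤ R / 2 * M + M' := by
  have hzA := H.subset hz
  have hi := abs_birkhoffSum_le H.mapsTo_base hφ hzA i
  have hj := abs_birkhoffSum_le H.mapsTo_base hφ (H.mapsTo_base.iterate i hzA) j
  have hsum := hφ' z hz
  rw [← hij, birkhoffSum_add] at hsum
  have hR' : (i : ℝ) + j ≤ R := by exact_mod_cast hij.trans_le (hR z hz)
  set a := birkhoffSum f φ i z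
  set b := birkhoffSum f φ j (f^[i] z)
  have h1 : |a| ≤ |a + b| + |b| := by simpa using abs_sub (a + b) b
  have h2 : |b| ≤ |a + b| + |a| := by simpa using abs_sub (a + b) a
  rcases le_total (i : ℝ) j with hle | hle
  · have : (i : ℝ) * M ≤ R / 2 * M := mul_le_mul_of_nonneg_right (by linarith) hM
    exact ⟨by linarith, by linarith⟩
  · have : (j : ℝ) * M ≤ R / 2 * M := mul_le_mul_of_nonneg_right (by linarith) hM
    exact ⟨by linarith, by linarith⟩

/-- Reduction of a Birkhoff sum of `f` along an orbit segment visiting `A'` to a Birkhoff sum of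
the induced map. -/
lemma exists_reduction (H : IsInduced f g A A' ρ) {φ : X → ℝ} {M M' : ℝ} {R : ℕ}
    (hφ : ∀ z ∈ A, |φ z| ≤ M) (hM : 0 ≤ M) (hM' : 0 ≤ M')
    (hφ' : ∀ z ∈ A', |birkhoffSum f φ (ρ z) z| ≤ M') (hR : ∀ z ∈ A', ρ z ≤ R)
    {x : X} (hx : x ∈ A) {N : ℕ} (hN : ∃ j ≤ N, f^[j] x ∈ A') :
    ∃ x' ∈ A', ∃ N' : ℕ, (∀ K < N', ∃ j < N, g^[K] x' = f^[j] x) ∧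
      (∀ j ≤ N, f^[j] x ∈ A' → ∃ K ≤ N', f^[j] x = g^[K] x') ∧
      |birkhoffSum f φ N x| ≤
        R * M + 2 * M' + |birkhoffSum g (fun w => birkhoffSum f φ (ρ w) w) N' x'| := by
  classical
  have hex : ∃ j, f^[j] x ∈ A' := hN.imp fun j hj => hj.2
  obtain ⟨s, hs, hmin⟩ : ∃ s, f^[s] x ∈ A' ∧ ∀ j < s, f^[j] x ∉ A' :=
    ⟨Nat.find hex, Nat.find_spec hex, fun j hj => Nat.find_min hex hj⟩
  have hsN : s ≤ N := by
    obtain ⟨j, hj, hjA⟩ := hN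
    exact (not_lt.1 fun hlt => hmin j hlt hjA).trans hj
  set x' := f^[s] x with hx'
  obtain ⟨N', e, he, hNe⟩ := H.exists_time_eq hs (N - s)
  have hN_eq : N = s + (birkhoffSum g ρ N' x' + e) := by omega
  refine ⟨x', hs, N', fun K hK => ⟨birkhoffSum g ρ K x' + s, ?_, ?_⟩, fun j hj hjA => ?_, ?_⟩
  · have : birkhoffSum g ρ K x' < birkhoffSum g ρ N' x' := H.time_strictMono hs hK
    omega
  · rw [Function.iterate_add_apply, ← hx', H.iterate_time hs]
  · have hsj : s ≤ j := not_lt.1 fun hlt => hmin j hlt hjA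
    have hj_eq : f^[j] x = f^[j - s] x' := by
      rw [hx', ← Function.iterate_add_apply, Nat.sub_add_cancel hsj]
    rw [hj_eq] at hjA
    obtain ⟨K, hK⟩ := H.exists_time_of_mem hs hjA
    refine ⟨K, ?_, by rw [hj_eq, hK, H.iterate_time hs]⟩
    have hlt : birkhoffSum g ρ K x' < birkhoffSum g ρ (N' + 1) x' := by
      rw [birkhoffSum_succ]
      omega
    exact Nat.lt_succ_iff.1 ((H.time_strictMono hs).lt_iff_lt.1 hlt)
  · have hstart : |birkhoffSum f φ s x| ≤ R / 2 * M + M' := by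
      obtain ⟨w, hw, j, hj, rfl⟩ := H.cover x hx
      rcases Nat.eq_zero_or_pos s with rfl | hs0
      · simp only [birkhoffSum_zero, abs_zero]
        positivity
      have hj0 : 0 < j := by
        rcases Nat.eq_zero_or_pos j with rfl | hj0
        · exact absurd hw (hmin 0 hs0)
        · exact hj0
      have hle : s ≤ ρ w - j := by
        refine not_lt.1 fun hlt => hmin _ hlt ?_
        rw [← Function.iterate_add_apply, Nat.sub_add_cancel hj.le, H.map_eq w hw]
        exact H.mapsTo hw
      have hge : ρ w ≤ s + j := by
        refine not_lt.1 fun hlt => H.avoid w hw (s + j) (by omega) hlt ?_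
        rwa [Function.iterate_add_apply]
      exact (H.abs_le_of_cut hφ hM hM' hφ' hR hw (i := j) (j := s) (by omega)).2
    have hend : |birkhoffSum f φ e (g^[N'] x')| ≤ R / 2 * M + M' :=
      (H.abs_le_of_cut hφ hM hM' hφ' hR (H.mapsTo.iterate N' hs)
        (j := ρ (g^[N'] x') - e) (Nat.add_sub_cancel' he.le)).1
    rw [hN_eq, birkhoffSum_add, birkhoffSum_add, ← hx', H.iterate_time hs,
      H.birkhoffSum_induced φ hs]
    calc _ ≤ |birkhoffSum f φ s x| + (|birkhoffSum f φ (birkhoffSum g ρ N' x') x'| +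
          |birkhoffSum f φ e (g^[N'] x')|) :=
          (abs_add_le _ _).trans (by gcongr; exact abs_add_le _ _)
      _ ≤ _ := by linarith

end IsInduced

lemma IsInduced.congr {X : Type*} {f g g' : X → X} {A A' : Set X} {ρ ρ' : X → ℕ}
    (H : IsInduced f g A A' ρ) (hg : ∀ z ∈ A', g' z = g z) (hρ : ∀ z ∈ A', ρ' z = ρ z) :
    IsInduced f g' A A' ρ' where
  mapsTo_base := H.mapsTo_base
  subset := H.subset
  mapsTo z hz := by rw [hg z hz]; exact H.mapsTo hz
  pos z hz := by rw [hρ z hz]; exact H.pos z hz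
  map_eq z hz := by rw [hρ z hz, hg z hz]; exact H.map_eq z hz
  avoid z hz := by rw [hρ z hz]; exact H.avoid z hz
  cover x hx := by
    obtain ⟨z, hz, j, hj, rfl⟩ := H.cover x hx
    exact ⟨z, hz, j, by rwa [hρ z hz], rfl⟩

/-- Sum of the weights of the letters at the first `k` positions. -/
def partialSum {d : ℕ} (w : Fin d → ℝ) (e : Fin d ≃ Fin d) (k : ℕ) : ℝ :=
  ∑ a ∈ Finset.univ.filter (fun a => (e a : ℕ) < k), w a

section PartialSum

variable {d : ℕ} {w : Fin d → ℝ} (e : Fin d ≃ Fin d)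

lemma partialSum_zero : partialSum w e 0 = 0 := by simp [partialSum]

lemma partialSum_card : partialSum w e d = ∑ a, w a := by simp [partialSum]

lemma partialSum_succ (a : Fin d) : partialSum w e (e a + 1) = partialSum w e (e a) + w a := by
  have : Finset.univ.filter (fun b => (e b : ℕ) < e a + 1) =
      insert a (Finset.univ.filter (fun b => (e b : ℕ) < e a)) := by
    ext b
    simp only [Finset.mem_filter, Finset.mem_univ, true_and, Finset.mem_insert,
      Nat.lt_succ_iff_lt_or_eq]
    rw [← Fin.ext_iff, e.injective.eq_iff, or_comm]
  rw [partialSum, this, Finset.sum_insert (by simp), add_comm, partialSum]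

lemma partialSum_mono (hw : ∀ a, 0 < w a) : Monotone (partialSum w e) := by
  intro k l hkl
  refine Finset.sum_le_sum_of_subset_of_nonneg (fun a ha => ?_) fun a _ _ => (hw a).le
  simp only [Finset.mem_filter, Finset.mem_univ, true_and] at ha ⊢
  omega

lemma eq_of_mem_Ico_partialSum (hw : ∀ a, 0 < w a) {a b : Fin d} {x : ℝ}
    (ha : x ∈ Ico (partialSum w e (e a)) (partialSum w e (e a) + w a))
    (hb : x ∈ Ico (partialSum w e (e b)) (partialSum w e (e b) + w b)) : a = b := by
  rw [← partialSum_succ] at ha hb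
  refine e.injective (Fin.ext (le_antisymm ?_ ?_))
  · refine not_lt.1 fun hlt => ?_
    have := partialSum_mono e hw (Nat.succ_le_of_lt hlt)
    have h1 := ha.1
    have h2 := hb.2
    simp only [Nat.succ_eq_add_one] at this
    linarith
  · refine not_lt.1 fun hlt => ?_
    have := partialSum_mono e hw (Nat.succ_le_of_lt hlt)
    have h1 := hb.1
    have h2 := ha.2
    simp only [Nat.succ_eq_add_one] at this
    linarith

lemma exists_mem_Ico_partialSum {x : ℝ} (hx0 : 0 ≤ x) (hx : x < ∑ a, w a) :
    ∃ a, x ∈ Ico (partialSum w e (e a)) (partialSum w e (e a) + w a) := by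
  rw [← partialSum_card e] at hx
  have hex : ∃ k, x < partialSum w e k := ⟨d, hx⟩
  have hfind := Nat.find_spec hex
  have hle : Nat.find hex ≤ d := Nat.find_min' hex hx
  have hne : Nat.find hex ≠ 0 := fun h0 => by
    rw [h0, partialSum_zero] at hfind
    linarith
  obtain ⟨k, hk⟩ := Nat.exists_eq_succ_of_ne_zero hne
  have hmin := Nat.find_min hex (show k < Nat.find hex by omega)
  refine ⟨e.symm ⟨k, by omega⟩, ?_⟩
  rw [← partialSum_succ]
  simp only [Equiv.apply_symm_apply]
  rw [hk] at hfind
  exact ⟨not_lt.1 hmin, hfind⟩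

lemma sum_partialSum_sub (F : ℝ → ℝ) :
    ∑ a, (F (partialSum w e (e a) + w a) - F (partialSum w e (e a))) =
      F (∑ a, w a) - F 0 := by
  simp_rw [← partialSum_succ]
  rw [Equiv.sum_comp e (fun i : Fin d => F (partialSum w e (i + 1)) - F (partialSum w e i)),
    Fin.sum_univ_eq_sum_range (fun i : ℕ => F (partialSum w e (i + 1)) - F (partialSum w e i)),
    Finset.sum_range_sub (fun i => F (partialSum w e i)), partialSum_card, partialSum_zero]

end PartialSum

namespace IET

variable {d : ℕ} (T : IET d)

lemma upt_succ (a : Fin d) : T.upt (T.pit a + 1) = T.rept a := partialSum_succ T.pit a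

lemma vpt_succ (a : Fin d) : T.vpt (T.pib a + 1) = T.repb a := partialSum_succ T.pib a

lemma upt_mono : Monotone T.upt := partialSum_mono T.pit T.lam_pos

lemma vpt_mono : Monotone T.vpt := partialSum_mono T.pib T.lam_pos

lemma upt_zero : T.upt 0 = 0 := partialSum_zero T.pit

lemma vpt_zero : T.vpt 0 = 0 := partialSum_zero T.pib

lemma upt_card : T.upt d = T.len := partialSum_card T.pit

lemma vpt_card : T.vpt d = T.len := partialSum_card T.pib

lemma lept_lt_rept (a : Fin d) : T.lept a < T.rept a := lt_add_of_pos_right _ (T.lam_pos a)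

lemma rept_eq (a : Fin d) : T.rept a = T.lept a + T.lam a := rfl

lemma repb_eq (a : Fin d) : T.repb a = T.lepb a + T.lam a := rfl

lemma lept_nonneg (a : Fin d) : 0 ≤ T.lept a := T.upt_zero ▸ T.upt_mono (Nat.zero_le _)

lemma lepb_nonneg (a : Fin d) : 0 ≤ T.lepb a := T.vpt_zero ▸ T.vpt_mono (Nat.zero_le _)

lemma rept_le_len (a : Fin d) : T.rept a ≤ T.len := by
  rw [← T.upt_succ, ← T.upt_card]
  exact T.upt_mono (T.pit a).isLt

lemma repb_le_len (a : Fin d) : T.repb a ≤ T.len := by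
  rw [← T.vpt_succ, ← T.vpt_card]
  exact T.vpt_mono (T.pib a).isLt

lemma exists_mem_topI {x : ℝ} (hx : x ∈ T.domain) : ∃ a, x ∈ T.topI a :=
  exists_mem_Ico_partialSum T.pit hx.1 hx.2

lemma exists_mem_botI {x : ℝ} (hx : x ∈ T.domain) : ∃ a, x ∈ T.botI a :=
  exists_mem_Ico_partialSum T.pib hx.1 hx.2

variable {T}

lemma eq_of_mem_topI {a b : Fin d} {x : ℝ} (ha : x ∈ T.topI a) (hb : x ∈ T.topI b) : a = b :=
  eq_of_mem_Ico_partialSum T.pit T.lam_pos ha hb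

lemma mem_domain_of_mem_topI {a : Fin d} {x : ℝ} (hx : x ∈ T.topI a) : x ∈ T.domain :=
  ⟨(T.lept_nonneg a).trans hx.1, hx.2.trans_le (T.rept_le_len a)⟩

lemma toFun_of_mem {a : Fin d} {x : ℝ} (hx : x ∈ T.topI a) :
    T.toFun x = x - T.lept a + T.lepb a := by
  have hex : ∃ a : Fin d, x ∈ T.topI a := ⟨a, hx⟩
  rw [toFun, dif_pos hex, eq_of_mem_topI hex.choose_spec hx]

lemma toFun_mem_botI {a : Fin d} {x : ℝ} (hx : x ∈ T.topI a) : T.toFun x ∈ T.botI a := by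
  rw [toFun_of_mem hx]
  have h1 := hx.1
  have h2 := hx.2
  rw [rept_eq] at h2
  constructor
  · linarith
  · rw [repb_eq]; linarith

lemma toFun_mem_domain {x : ℝ} (hx : x ∈ T.domain) : T.toFun x ∈ T.domain := by
  obtain ⟨a, ha⟩ := T.exists_mem_topI hx
  have := toFun_mem_botI ha
  exact ⟨(T.lepb_nonneg a).trans this.1, this.2.trans_le (T.repb_le_len a)⟩

lemma exists_toFun_eq {x : ℝ} (hx : x ∈ T.domain) : ∃ z ∈ T.domain, T.toFun z = x := by
  obtain ⟨a, ha⟩ := T.exists_mem_botI hx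
  have h1 := ha.1
  have h2 := ha.2
  rw [repb_eq] at h2
  have hz : x - T.lepb a + T.lept a ∈ T.topI a := by
    constructor
    · linarith
    · rw [rept_eq]; linarith
  exact ⟨_, mem_domain_of_mem_topI hz, by rw [toFun_of_mem hz]; ring⟩

/-- If the lengths of the intervals `I_a^t(T)`, weighted by natural numbers which are `1` for the
intervals inside `[s, e)` and `0` for those outside, add up to `e - s`, and if at most one of the
intervals is neither inside nor outside, then there is no such interval. -/
lemma not_straddle {n : Fin d → ℕ} {s e : ℝ} (hs : 0 ≤ s) (hse : s < e) (he : e ≤ T.len)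
    (hsum : ∑ a, (n a : ℝ) * T.lam a = e - s)
    (hin : ∀ a, s ≤ T.lept a → T.rept a ≤ e → n a = 1)
    (hout : ∀ a, T.rept a ≤ s ∨ e ≤ T.lept a → n a = 0) {a₀ : Fin d}
    (huniq : ∀ a, a ≠ a₀ → (s ≤ T.lept a ∧ T.rept a ≤ e) ∨ T.rept a ≤ s ∨ e ≤ T.lept a) :
    (s ≤ T.lept a₀ ∧ T.rept a₀ ≤ e) ∨ T.rept a₀ ≤ s ∨ e ≤ T.lept a₀ := by
  by_contra hcon
  push Not at hcon
  obtain ⟨hc1, hc2, hc3⟩ := hcon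
  set F : ℝ → ℝ := fun t => min (max t s) e with hF
  have htot : ∑ a, (F (T.rept a) - F (T.lept a)) = e - s := by
    have := sum_partialSum_sub (w := T.lam) T.pit F
    refine this.trans ?_
    change F T.len - F 0 = e - s
    rw [hF]
    simp only
    rw [max_eq_left (by linarith), min_eq_right he, max_eq_right hs, min_eq_left hse.le]
  have hothers : ∀ a ≠ a₀, (n a : ℝ) * T.lam a = F (T.rept a) - F (T.lept a) := by
    intro a ha
    have hlt := T.lept_lt_rept a
    rcases huniq a ha with ⟨h1, h2⟩ | hor
    · rw [hin a h1 h2]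
      simp only [hF]
      rw [max_eq_left (by linarith), max_eq_left h1, min_eq_left h2, min_eq_left (by linarith),
        rept_eq]
      push_cast
      ring
    · rw [hout a hor]
      simp only [hF]
      rcases hor with h1 | h1
      · rw [max_eq_right h1, max_eq_right (by linarith)]
        simp
      · rw [max_eq_left (by linarith), max_eq_left (by linarith), min_eq_right (by linarith),
          min_eq_right h1]
        simp
  have hkey : (n a₀ : ℝ) * T.lam a₀ = F (T.rept a₀) - F (T.lept a₀) := by
    have h1 := hsum.trans htot.symm
    rw [← Finset.add_sum_erase _ _ (Finset.mem_univ a₀),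
      ← Finset.add_sum_erase _ _ (Finset.mem_univ a₀),
      Finset.sum_congr rfl fun a ha => hothers a (Finset.ne_of_mem_erase ha)] at h1
    linarith
  have hlt := T.lept_lt_rept a₀
  have hpos : 0 < F (T.rept a₀) - F (T.lept a₀) := by
    simp only [hF]
    rw [max_eq_left hc2.le, min_eq_left (a := max _ _) (max_lt hc3 hse).le, sub_pos]
    exact lt_min (max_lt hlt hc2) (max_lt hc3 hse)
  have hsmall : F (T.rept a₀) - F (T.lept a₀) < T.lam a₀ := by
    have hlam : T.lam a₀ = T.rept a₀ - T.lept a₀ := by rw [rept_eq]; ring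
    simp only [hF]
    rw [max_eq_left hc2.le, min_eq_left (a := max _ _) (max_lt hc3 hse).le, hlam]
    have h1 := min_le_left (T.rept a₀) e
    have h2 := min_le_right (T.rept a₀) e
    have h3 := le_max_left (T.lept a₀) s
    have h4 := le_max_right (T.lept a₀) s
    rcases lt_or_ge (T.lept a₀) s with h | h
    · linarith
    · have := hc1 h
      linarith
  rw [← hkey] at hpos hsmall
  rcases Nat.eq_zero_or_pos (n a₀) with h0 | h0
  · simp [h0] at hpos
  · have h1 : (1 : ℝ) ≤ n a₀ := by exact_mod_cast h0
    nlinarith [T.lam_pos a₀]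

end IET

/-- One step of the Rauzy–Veech algorithm from `T` to `T'`, with matrix `B`. -/
structure IsRauzyStep {d : ℕ} (T T' : IET d) (B : Matrix (Fin d) (Fin d) ℕ) : Prop where
  len_eq : T'.len = max (T.upt (d - 1)) (T.vpt (d - 1))
  step : ∃ F : Finset ℝ, ∀ x ∈ T'.domain, x ∉ F →
    T'.toFun x = firstReturnMap T.toFun T'.domain x
  lam_eq : ∀ b, T.lam b = ∑ a, (B a b : ℝ) * T'.lam a
  visits : ∀ a b : Fin d, ∃ x ∈ T'.topI a, (B a b : ℕ) = Nat.card {j : ℕ |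
    j < firstReturnTime T.toFun T'.domain x ∧ T.toFun^[j] x ∈ T.topI b}

namespace IET

variable {d : ℕ} {T : IET d} {α β : Fin d}

lemma upt_pred (hα : (T.pit α : ℕ) + 1 = d) : T.upt (d - 1) = T.lept α := by
  rw [lept, show (T.pit α : ℕ) = d - 1 by omega]

lemma vpt_pred (hβ : (T.pib β : ℕ) + 1 = d) : T.vpt (d - 1) = T.lepb β := by
  rw [lepb, show (T.pib β : ℕ) = d - 1 by omega]

lemma rept_last (hα : (T.pit α : ℕ) + 1 = d) : T.rept α = T.len := by
  rw [← upt_succ, hα, upt_card]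

lemma repb_last (hβ : (T.pib β : ℕ) + 1 = d) : T.repb β = T.len := by
  rw [← vpt_succ, hβ, vpt_card]

lemma rept_le_of_ne (hα : (T.pit α : ℕ) + 1 = d) {b : Fin d} (hb : b ≠ α) :
    T.rept b ≤ T.upt (d - 1) := by
  rw [← upt_succ]
  refine T.upt_mono ?_
  have : (T.pit b : ℕ) ≠ T.pit α := fun h => hb (T.pit.injective (Fin.ext h))
  have := (T.pit b).isLt
  omega

lemma repb_le_of_ne (hβ : (T.pib β : ℕ) + 1 = d) {b : Fin d} (hb : b ≠ β) :
    T.repb b ≤ T.vpt (d - 1) := by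
  rw [← vpt_succ]
  refine T.vpt_mono ?_
  have : (T.pib b : ℕ) ≠ T.pib β := fun h => hb (T.pib.injective (Fin.ext h))
  have := (T.pib b).isLt
  omega

lemma last_ne_last (hd : 2 ≤ d) (hα : (T.pit α : ℕ) + 1 = d) (hβ : (T.pib β : ℕ) + 1 = d) :
    α ≠ β := by
  rintro rfl
  refine T.irred (d - 1) (by omega) (by omega) (Finset.filter_congr fun b _ => ?_)
  rcases eq_or_ne b α with rfl | hb
  · omega
  · have h1 : (T.pit b : ℕ) ≠ T.pit α := fun h => hb (T.pit.injective (Fin.ext h))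
    have h2 : (T.pib b : ℕ) ≠ T.pib α := fun h => hb (T.pib.injective (Fin.ext h))
    have := (T.pit b).isLt
    have := (T.pib b).isLt
    omega

lemma exists_last (T : IET d) (hd : 2 ≤ d) :
    ∃ α β, (T.pit α : ℕ) + 1 = d ∧ (T.pib β : ℕ) + 1 = d :=
  ⟨T.pit.symm ⟨d - 1, by omega⟩, T.pib.symm ⟨d - 1, by omega⟩,
    by simp only [Equiv.apply_symm_apply]; omega, by simp only [Equiv.apply_symm_apply]; omega⟩

end IET

lemma natCard_setOf_lt_and (r : ℕ) (P : ℕ → Prop) [DecidablePred P] :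
    Nat.card {j : ℕ | j < r ∧ P j} = ∑ j ∈ Finset.range r, if P j then 1 else 0 := by
  rw [← Finset.card_filter, ← Nat.card_eq_finsetCard]
  exact Nat.card_congr (Equiv.subtypeEquivRight fun j => by simp)

namespace IsRauzyStep

variable {d : ℕ} {T T' : IET d} {B : Matrix (Fin d) (Fin d) ℕ} {α β : Fin d}

lemma len_le (H : IsRauzyStep T T' B) : T'.len ≤ T.len := by
  rw [H.len_eq, ← T.upt_card]
  refine max_le (T.upt_mono (Nat.sub_le d 1)) ?_
  rw [T.upt_card, ← T.vpt_card]
  exact T.vpt_mono (Nat.sub_le d 1)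

lemma domain_subset (H : IsRauzyStep T T' B) : T'.domain ⊆ T.domain :=
  Ico_subset_Ico_right H.len_le

lemma mem_topI_last (H : IsRauzyStep T T' B) (hα : (T.pit α : ℕ) + 1 = d) {x : ℝ}
    (hx : x ∈ T.domain) (hle : T'.len ≤ x) : x ∈ T.topI α := by
  refine ⟨?_, by rw [IET.rept_last hα]; exact hx.2⟩
  rw [← IET.upt_pred hα]
  exact (le_max_left _ _).trans (H.len_eq ▸ hle)

lemma toFun_lt (H : IsRauzyStep T T' B) (hd : 2 ≤ d) (hα : (T.pit α : ℕ) + 1 = d) {x : ℝ}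
    (hx : x ∈ T.topI α) : T.toFun x < T'.len := by
  obtain ⟨-, β, -, hβ⟩ := T.exists_last hd
  rw [H.len_eq]
  exact (IET.toFun_mem_botI hx).2.trans_le
    ((IET.repb_le_of_ne hβ (IET.last_ne_last hd hα hβ)).trans (le_max_right _ _))

lemma isInduced_aux (H : IsRauzyStep T T' B) (hd : 2 ≤ d) :
    IsInduced T.toFun
      (fun z => T.toFun^[if T.toFun z < T'.len then 1 else 2] z) T.domain T'.domain
      (fun z => if T.toFun z < T'.len then 1 else 2) where
  mapsTo_base _ hx := IET.toFun_mem_domain hx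
  subset := H.domain_subset
  mapsTo z hz := by
    obtain ⟨α, -, hα, -⟩ := T.exists_last hd
    have hz1 := IET.toFun_mem_domain (H.domain_subset hz)
    dsimp only
    split_ifs with h
    · exact ⟨hz1.1, h⟩
    · exact ⟨(IET.toFun_mem_domain hz1).1,
        H.toFun_lt hd hα (H.mem_topI_last hα hz1 (not_lt.1 h))⟩
  pos z _ := by split_ifs <;> norm_num
  map_eq _ _ := rfl
  avoid z hz j h0 hj := by
    split_ifs at hj with h
    · omega
    · obtain rfl : j = 1 := by omega
      exact fun hmem => h hmem.2
  cover x hx := by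
    by_cases hlt : x < T'.len
    · exact ⟨x, ⟨hx.1, hlt⟩, 0, by split_ifs <;> norm_num, rfl⟩
    · obtain ⟨α, -, hα, -⟩ := T.exists_last hd
      obtain ⟨z, hz, rfl⟩ := IET.exists_toFun_eq hx
      refine ⟨z, ⟨hz.1, not_le.1 fun hle => hlt (H.toFun_lt hd hα (H.mem_topI_last hα hz hle))⟩,
        1, ?_, rfl⟩
      rw [if_neg hlt]
      norm_num

lemma card_visits (H : IsRauzyStep T T' B) (hd : 2 ≤ d) (hα : (T.pit α : ℕ) + 1 = d) {z : ℝ}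
    (hz : z ∈ T'.domain) (b : Fin d) :
    Nat.card {j : ℕ | j < firstReturnTime T.toFun T'.domain z ∧ T.toFun^[j] z ∈ T.topI b} =
      (if z ∈ T.topI b then 1 else 0) + if b = α ∧ T'.len ≤ T.toFun z then 1 else 0 := by
  rw [natCard_setOf_lt_and, (H.isInduced_aux hd).firstReturnTime_eq hz]
  by_cases h : T.toFun z < T'.len
  · have h0 : ¬(b = α ∧ T'.len ≤ T.toFun z) := fun hb => not_lt.2 hb.2 h
    rw [if_pos h, Finset.sum_range_one, if_neg h0, add_zero, Function.iterate_zero, id_eq]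
  · have hmem := H.mem_topI_last hα (IET.toFun_mem_domain (H.domain_subset hz)) (not_lt.1 h)
    have hiff : T.toFun z ∈ T.topI b ↔ b = α :=
      ⟨fun hb => IET.eq_of_mem_topI hb hmem, fun hb => hb ▸ hmem⟩
    simp only [if_neg h, Finset.sum_range_succ, Finset.sum_range_zero, zero_add,
      Function.iterate_zero, id_eq, Function.iterate_one, hiff, not_lt.1 h, and_true]
    congr

lemma topI_subset_domain (a : Fin d) : T'.topI a ⊆ T'.domain :=
  fun _ hx => IET.mem_domain_of_mem_topI hx

lemma not_straddle_upt (H : IsRauzyStep T T' B) (hd : 2 ≤ d) {k : ℕ} (hk : k ≤ d - 1)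
    (a : Fin d) : T'.rept a ≤ T.upt k ∨ T.upt k ≤ T'.lept a := by
  obtain ⟨α, -, hα, -⟩ := T.exists_last hd
  induction k generalizing a with
  | zero => exact Or.inr (by rw [T.upt_zero]; exact T'.lept_nonneg a)
  | succ k ih =>
    have ih := ih (by omega)
    obtain ⟨b, hb⟩ : ∃ b, (T.pit b : ℕ) = k := ⟨T.pit.symm ⟨k, by omega⟩, by simp⟩
    have hbα : b ≠ α := by
      rintro rfl
      omega
    have hs : T.upt k = T.lept b := by rw [IET.lept, hb]
    have he : T.upt (k + 1) = T.rept b := by rw [← T.upt_succ, hb]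
    rw [he]
    rw [hs] at ih
    by_contra hcon
    push Not at hcon
    obtain ⟨hc1, hc2⟩ := hcon
    have hbe := T.lept_lt_rept b
    have hcard : ∀ a', ∃ x ∈ T'.topI a', B a' b = if x ∈ T.topI b then 1 else 0 := by
      intro a'
      obtain ⟨x, hx, hBx⟩ := H.visits a' b
      refine ⟨x, hx, ?_⟩
      rw [hBx, H.card_visits hd hα (topI_subset_domain a' hx)]
      simp [hbα]
    have := IET.not_straddle (T := T') (n := fun a' => B a' b) (s := T.lept b) (e := T.rept b)
      (a₀ := a) (T.lept_nonneg b) hbe ?_ ?_ ?_ ?_ ?_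
    · have := ih a
      rcases this with h | h <;> grind
    · rw [H.len_eq]
      exact (IET.rept_le_of_ne hα hbα).trans (le_max_left _ _)
    · rw [← H.lam_eq, IET.rept_eq]
      ring
    · intro a' h1 h2
      obtain ⟨x, hx, hBx⟩ := hcard a'
      rw [hBx, if_pos ⟨h1.trans hx.1, hx.2.trans_le h2⟩]
    · intro a' hor
      obtain ⟨x, hx, hBx⟩ := hcard a'
      rw [hBx, if_neg]
      intro hxb
      rcases hor with h | h
      · exact absurd (hx.2.trans_le h) (not_lt.2 hxb.1)
      · exact absurd (hxb.2.trans_le h) (not_lt.2 hx.1)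
    · intro a' ha'
      by_contra hcon'
      push Not at hcon'
      obtain ⟨h1, h2, h3⟩ := hcon'
      have hl : T.lept b ≤ T'.lept a' := (ih a').resolve_left (not_le.2 h2)
      exact ha' (IET.eq_of_mem_topI (x := T.rept b) ⟨h3.le, h1 hl⟩ ⟨hc2.le, hc1⟩)

/-- Each top interval of `T'` lies inside a top interval of `T`. -/
lemma exists_topI_subset (H : IsRauzyStep T T' B) (hd : 2 ≤ d) (a : Fin d) :
    ∃ b, T'.topI a ⊆ T.topI b := by
  obtain ⟨α, -, hα, -⟩ := T.exists_last hd
  have hmem : T'.lept a ∈ T'.topI a := ⟨le_rfl, T'.lept_lt_rept a⟩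
  obtain ⟨b, hb⟩ := T.exists_mem_topI (H.domain_subset (topI_subset_domain a hmem))
  refine ⟨b, Ico_subset_Ico hb.1 ?_⟩
  rcases eq_or_ne b α with rfl | hbα
  · rw [IET.rept_last hα]
    exact (T'.rept_le_len a).trans H.len_le
  · have hk : (T.pit b : ℕ) + 1 ≤ d - 1 := by
      have : (T.pit b : ℕ) ≠ T.pit α := fun h => hbα (T.pit.injective (Fin.ext h))
      have := (T.pit b).isLt
      omega
    rw [← T.upt_succ]
    refine (H.not_straddle_upt hd hk a).resolve_right (not_le.2 ?_)
    rw [T.upt_succ]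
    exact hb.2

lemma toFun_lt_iff (H : IsRauzyStep T T' B) (hd : 2 ≤ d) {a : Fin d} {z z' : ℝ}
    (hz : z ∈ T'.topI a) (hz' : z' ∈ T'.topI a) :
    T.toFun z < T'.len ↔ T.toFun z' < T'.len := by
  obtain ⟨α, β, hα, hβ⟩ := T.exists_last hd
  have hαβ := IET.last_ne_last hd hα hβ
  obtain ⟨b, hb⟩ := H.exists_topI_subset hd a
  have hv : T.vpt (d - 1) ≤ T'.len := H.len_eq ▸ le_max_right _ _
  rcases ne_or_eq b β with hbβ | rfl
  · have hlt : ∀ w ∈ T'.topI a, T.toFun w < T'.len := fun w hw =>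
      (IET.toFun_mem_botI (hb hw)).2.trans_le ((IET.repb_le_of_ne hβ hbβ).trans hv)
    exact iff_of_true (hlt z hz) (hlt z' hz')
  rcases lt_or_ge (T.upt (d - 1)) (T.vpt (d - 1)) with hcase | hcase
  · have hle : ∀ w ∈ T'.topI a, ¬ T.toFun w < T'.len := fun w hw => by
      rw [H.len_eq, max_eq_right hcase.le, IET.vpt_pred hβ]
      exact not_lt.2 (IET.toFun_mem_botI (hb hw)).1
    exact iff_of_false (hle z hz) (hle z' hz')
  have hL : T'.len = T.lept α := by rw [H.len_eq, max_eq_left hcase, IET.upt_pred hα]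
  rw [IET.vpt_pred hβ, IET.upt_pred hα, ← hL] at hcase
  set c := T.lept b - T.lepb b + T'.len with hc
  have hlen : T.lepb b + T.lam b = T.lept α + T.lam α := by
    rw [← T.repb_eq, ← T.rept_eq, IET.repb_last hβ, IET.rept_last hα]
  have hcr : T.rept b - c = T.lam α := by
    rw [T.rept_eq, hc, hL]
    linarith
  have hlc : T.lept b ≤ c := by linarith
  have hrL : T.rept b ≤ T'.len := by
    rw [hL, ← IET.upt_pred hα]
    exact IET.rept_le_of_ne hα hαβ.symm
  have hchar : ∀ w ∈ T.topI b, (T.toFun w < T'.len ↔ w < c) := fun w hw => by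
    rw [IET.toFun_of_mem hw, hc]
    constructor <;> intro h <;> linarith
  have hmemiff : ∀ w ∈ T'.domain, (T'.len ≤ T.toFun w ↔ w ∈ Ico c (T.rept b)) := by
    intro w hw
    constructor
    · intro hle
      have hwdom := H.domain_subset hw
      obtain ⟨b', hb'⟩ := T.exists_mem_topI hwdom
      have hbb' : b' = b := by
        by_contra hne
        exact absurd ((IET.toFun_mem_botI hb').2.trans_le
          ((IET.repb_le_of_ne hβ hne).trans hv)) (not_lt.2 hle)
      subst hbb'
      exact ⟨not_lt.1 fun h => absurd ((hchar w hb').2 h) (not_lt.2 hle), hb'.2⟩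
    · rintro ⟨h1, h2⟩
      have hwb : w ∈ T.topI b := ⟨hlc.trans h1, h2⟩
      exact not_lt.1 fun h => absurd ((hchar w hwb).1 h) (not_lt.2 h1)
  have hcard : ∀ a', ∃ x ∈ T'.topI a', B a' α = if x ∈ Ico c (T.rept b) then 1 else 0 := by
    intro a'
    obtain ⟨x, hx, hBx⟩ := H.visits a' α
    have hxd := topI_subset_domain a' hx
    refine ⟨x, hx, ?_⟩
    have hxα : x ∉ T.topI α := fun h => absurd hxd.2 (not_lt.2 (hL ▸ h.1))
    rw [hBx, H.card_visits hd hα hxd, if_neg hxα, zero_add]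
    simp only [true_and, hmemiff x hxd]
  have hzb := hb hz
  have hzb' := hb hz'
  rw [hchar z hzb, hchar z' hzb']
  by_contra hne
  have hsplit : T'.lept a < c ∧ c < T'.rept a := by
    have h1 := hz.1
    have h2 := hz.2
    have h3 := hz'.1
    have h4 := hz'.2
    grind
  have := IET.not_straddle (T := T') (n := fun a' => B a' α) (s := c) (e := T.rept b)
    (a₀ := a) ((T.lept_nonneg b).trans hlc) (by linarith [T.lam_pos α]) hrL ?_ ?_ ?_ ?_
  · have hcb : c < T.rept b := by linarith [T.lam_pos α]
    rcases this with h | h | h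
    · linarith [h.1]
    · linarith
    · linarith
  · rw [← H.lam_eq, hcr]
  · intro a' h1 h2
    obtain ⟨x, hx, hBx⟩ := hcard a'
    rw [hBx, if_pos ⟨h1.trans hx.1, hx.2.trans_le h2⟩]
  · intro a' hor
    obtain ⟨x, hx, hBx⟩ := hcard a'
    rw [hBx, if_neg]
    intro hxb
    rcases hor with h | h
    · exact absurd (hx.2.trans_le h) (not_lt.2 hxb.1)
    · exact absurd (hxb.2.trans_le h) (not_lt.2 hx.1)
  · intro a' ha'
    by_contra hcon'
    push Not at hcon'
    obtain ⟨h1, h2, h3⟩ := hcon'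
    have hl : c ≤ T'.lept a' := not_lt.1 fun hlt =>
      ha' (IET.eq_of_mem_topI (x := c) ⟨hlt.le, h2⟩ ⟨hsplit.1.le, hsplit.2⟩)
    obtain ⟨b', hb'⟩ := H.exists_topI_subset hd a'
    have hlmem : T'.lept a' ∈ T'.topI a' := ⟨le_rfl, T'.lept_lt_rept a'⟩
    have hbb' : b' = b := IET.eq_of_mem_topI (hb' hlmem) ⟨hlc.trans hl, h3⟩
    subst hbb'
    have hsub := (Ico_subset_Ico_iff (T'.lept_lt_rept a')).1 hb'
    exact absurd (h1 hl) (not_lt.2 hsub.2)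

lemma visits_eq (H : IsRauzyStep T T' B) (hd : 2 ≤ d) {a : Fin d} {z : ℝ}
    (hz : z ∈ T'.topI a) (b : Fin d) :
    B a b = Nat.card {j : ℕ |
      j < firstReturnTime T.toFun T'.domain z ∧ T.toFun^[j] z ∈ T.topI b} := by
  obtain ⟨α, -, hα, -⟩ := T.exists_last hd
  obtain ⟨x, hx, hBx⟩ := H.visits a b
  obtain ⟨c, hc⟩ := H.exists_topI_subset hd a
  have hxz : x ∈ T.topI b ↔ z ∈ T.topI b := by
    constructor
    · intro h
      exact IET.eq_of_mem_topI (hc hx) h ▸ hc hz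
    · intro h
      exact IET.eq_of_mem_topI (hc hz) h ▸ hc hx
  have hlt : T'.len ≤ T.toFun x ↔ T'.len ≤ T.toFun z := by
    rw [← not_lt, ← not_lt, H.toFun_lt_iff hd hx hz]
  rw [hBx, H.card_visits hd hα (topI_subset_domain a hx),
    H.card_visits hd hα (topI_subset_domain a hz)]
  simp only [hxz, hlt]

lemma toFun_eq (H : IsRauzyStep T T' B) (hd : 2 ≤ d) {z : ℝ} (hz : z ∈ T'.domain) :
    T'.toFun z = T.toFun^[if T.toFun z < T'.len then 1 else 2] z := by
  obtain ⟨α, -, hα, -⟩ := T.exists_last hd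
  obtain ⟨a, ha⟩ := T'.exists_mem_topI hz
  obtain ⟨F, hF⟩ := H.step
  obtain ⟨x, hx, hxF⟩ := (Ico_infinite (T'.lept_lt_rept a)).exists_notMem_finset F
  have hxd := topI_subset_domain a hx
  have hxeq := hF x hxd hxF
  rw [firstReturnMap, (H.isInduced_aux hd).firstReturnTime_eq hxd] at hxeq
  obtain ⟨c, hc⟩ := H.exists_topI_subset hd a
  have htrans : T'.toFun z - z = T'.toFun x - x := by
    rw [IET.toFun_of_mem ha, IET.toFun_of_mem hx]
    ring
  have htrans1 : T.toFun z - z = T.toFun x - x := by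
    rw [IET.toFun_of_mem (hc ha), IET.toFun_of_mem (hc hx)]
    ring
  have hiff := H.toFun_lt_iff hd ha hx
  by_cases h : T.toFun x < T'.len
  · rw [if_pos h] at hxeq
    rw [if_pos (hiff.2 h)]
    simp only [Function.iterate_one] at hxeq ⊢
    linarith
  · have h' := h
    rw [← hiff] at h'
    rw [if_neg h] at hxeq
    rw [if_neg h']
    simp only [Function.iterate_succ, Function.iterate_zero, Function.comp_apply, id_eq]
      at hxeq ⊢
    have hmx := H.mem_topI_last hα (IET.toFun_mem_domain (H.domain_subset hxd)) (not_lt.1 h)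
    have hmz := H.mem_topI_last hα (IET.toFun_mem_domain (H.domain_subset hz)) (not_lt.1 h')
    rw [IET.toFun_of_mem hmx] at hxeq
    rw [IET.toFun_of_mem hmz]
    linarith

lemma isInduced (H : IsRauzyStep T T' B) (hd : 2 ≤ d) :
    IsInduced T.toFun T'.toFun T.domain T'.domain (firstReturnTime T.toFun T'.domain) :=
  (H.isInduced_aux hd).congr (fun _ hz => H.toFun_eq hd hz)
    fun _ hz => (H.isInduced_aux hd).firstReturnTime_eq hz

end IsRauzyStep

lemma IsInduced.le_of_avoid {X : Type*} {f g : X → X} {A A' : Set X} {ρ : X → ℕ}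
    (H : IsInduced f g A A' ρ) {R : ℕ} (hR : ∀ z ∈ A', ρ z ≤ R) {x : X} (hx : x ∈ A) {N : ℕ}
    (hN : ∀ j < N, f^[j] x ∉ A') : N ≤ R := by
  obtain ⟨w, hw, j, hj, rfl⟩ := H.cover x hx
  refine le_trans (not_lt.1 fun hlt => hN (ρ w - j) (by omega) ?_) (hR w hw)
  rw [← Function.iterate_add_apply, Nat.sub_add_cancel hj.le, H.map_eq w hw]
  exact H.mapsTo hw

lemma mnorm_nonneg {d : ℕ} (M : Matrix (Fin d) (Fin d) ℕ) : 0 ≤ mnorm M :=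
  Finset.sum_nonneg fun _ _ => Finset.sum_nonneg fun _ _ => Nat.cast_nonneg _

lemma mnorm_eq {d : ℕ} (M : Matrix (Fin d) (Fin d) ℕ) :
    mnorm M = ((∑ a, ∑ b, M a b : ℕ) : ℝ) := by
  push_cast
  rfl

lemma row_sum_add_two_le {d : ℕ} (hd : 2 ≤ d) {M : Matrix (Fin d) (Fin d) ℕ}
    (hM : ∀ a b, 0 < M a b) (a : Fin d) : ∑ b, M a b + 2 ≤ ∑ a', ∑ b, M a' b := by
  have : Nontrivial (Fin d) := Fin.nontrivial_iff_two_le.2 hd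
  obtain ⟨a', ha'⟩ := exists_ne a
  have h1 : 2 ≤ ∑ b, M a' b := by
    calc 2 ≤ ∑ _b : Fin d, 1 := by simpa using hd
      _ ≤ ∑ b, M a' b := Finset.sum_le_sum fun b _ => hM a' b
  have h2 : ∑ c ∈ {a, a'}, ∑ b, M c b ≤ ∑ c, ∑ b, M c b :=
    Finset.sum_le_sum_of_subset (Finset.subset_univ _)
  rw [Finset.sum_pair ha'.symm] at h2
  omega

lemma supAbsOn_nonneg (f : ℝ → ℝ) (s : Set ℝ) : 0 ≤ supAbsOn f s :=
  Real.sSup_nonneg (by rintro _ ⟨x, -, rfl⟩; exact abs_nonneg _)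

namespace RVTower

variable {d : ℕ} {T : IET d} (tw : RVTower d T)

lemma isRauzyStep (n : ℕ) : IsRauzyStep (tw.iet n) (tw.iet (n + 1)) (tw.B n (n + 1)) where
  len_eq := tw.len_succ n
  step := tw.step n
  lam_eq := tw.B_lam n (n + 1) (Nat.le_succ n)
  visits := tw.B_visits n (n + 1) (Nat.le_succ n)

lemma domain_antitone : Antitone fun n => (tw.iet n).domain :=
  antitone_nat_of_succ_le fun n => (tw.isRauzyStep n).domain_subset

lemma isInduced (hd : 2 ≤ d) {m n : ℕ} (hmn : m ≤ n) :
    IsInduced (tw.iet m).toFun (tw.iet n).toFun (tw.iet m).domain (tw.iet n).domain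
      (firstReturnTime (tw.iet m).toFun (tw.iet n).domain) := by
  induction n, hmn using Nat.le_induction with
  | base =>
    have H : IsInduced (tw.iet m).toFun (tw.iet m).toFun (tw.iet m).domain (tw.iet m).domain
        fun _ => 1 := IsInduced.id_induced fun _ hx => IET.toFun_mem_domain hx
    exact H.congr (fun _ _ => rfl) fun _ hz => H.firstReturnTime_eq hz
  | succ n hmn ih =>
    have H := ih.comp ((tw.isRauzyStep n).isInduced hd)
    exact H.congr (fun _ _ => rfl) fun _ hz => H.firstReturnTime_eq hz

lemma firstReturnTime_comp (hd : 2 ≤ d) {m n p : ℕ} (hmn : m ≤ n) (hnp : n ≤ p) {z : ℝ}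
    (hz : z ∈ (tw.iet p).domain) :
    firstReturnTime (tw.iet m).toFun (tw.iet p).domain z =
      birkhoffSum (tw.iet n).toFun (firstReturnTime (tw.iet m).toFun (tw.iet n).domain)
        (firstReturnTime (tw.iet n).toFun (tw.iet p).domain z) z :=
  ((tw.isInduced hd hmn).comp (tw.isInduced hd hnp)).firstReturnTime_eq hz

lemma sBS_comp (hd : 2 ≤ d) (φ : ℝ → ℝ) {m n p : ℕ} (hmn : m ≤ n) (hnp : n ≤ p) {z : ℝ}
    (hz : z ∈ (tw.iet p).domain) :
    sBS tw m p φ z = birkhoffSum (tw.iet n).toFun (sBS tw m n φ)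
      (firstReturnTime (tw.iet n).toFun (tw.iet p).domain z) z := by
  have h := (tw.isInduced hd hmn).birkhoffSum_induced φ (tw.domain_antitone hnp hz)
    (firstReturnTime (tw.iet n).toFun (tw.iet p).domain z)
  rw [← tw.firstReturnTime_comp hd hmn hnp hz] at h
  exact h.symm

lemma firstReturnTime_self {m : ℕ} {z : ℝ} (hz : z ∈ (tw.iet m).domain) :
    firstReturnTime (tw.iet m).toFun (tw.iet m).domain z = 1 :=
  (IsInduced.id_induced fun _ hx => IET.toFun_mem_domain hx).firstReturnTime_eq hz

lemma firstReturnTime_eq_row_sum (hd : 2 ≤ d) {m n : ℕ} (hmn : m ≤ n) {a : Fin d} {z : ℝ}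
    (hz : z ∈ (tw.iet n).topI a) :
    firstReturnTime (tw.iet m).toFun (tw.iet n).domain z = ∑ b, tw.B m n a b := by
  induction n, hmn using Nat.le_induction generalizing a z with
  | base =>
    rw [tw.firstReturnTime_self (IET.mem_domain_of_mem_topI hz), tw.B_self]
    simp [Matrix.one_apply]
  | succ n hmn ih =>
    have hzd := IET.mem_domain_of_mem_topI hz
    have hzn := tw.domain_antitone (Nat.le_succ n) hzd
    rw [tw.firstReturnTime_comp hd hmn (Nat.le_succ n) hzd,
      tw.B_cocycle m n (n + 1) hmn (Nat.le_succ n), birkhoffSum]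
    set r := firstReturnTime (tw.iet n).toFun (tw.iet (n + 1)).domain z with hr
    calc ∑ j ∈ Finset.range r, firstReturnTime (tw.iet m).toFun (tw.iet n).domain
          ((tw.iet n).toFun^[j] z)
        = ∑ j ∈ Finset.range r, ∑ c, (if (tw.iet n).toFun^[j] z ∈ (tw.iet n).topI c
            then 1 else 0) * ∑ b, tw.B m n c b := by
          refine Finset.sum_congr rfl fun j _ => ?_
          have hj : (tw.iet n).toFun^[j] z ∈ (tw.iet n).domain :=
            MapsTo.iterate (fun _ hx => IET.toFun_mem_domain hx) j hzn
          obtain ⟨c, hc⟩ := (tw.iet n).exists_mem_topI hj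
          refine (ih hc).trans (Eq.symm ((Finset.sum_eq_single c (fun c' _ hne => ?_) ?_).trans ?_))
          · rw [if_neg fun h => hne (IET.eq_of_mem_topI h hc), zero_mul]
          · simp
          · rw [if_pos hc, one_mul]
      _ = ∑ c, tw.B n (n + 1) a c * ∑ b, tw.B m n c b := by
          rw [Finset.sum_comm]
          refine Finset.sum_congr rfl fun c _ => ?_
          rw [(tw.isRauzyStep n).visits_eq hd hz c, natCard_setOf_lt_and, Finset.sum_mul]
      _ = ∑ b, (tw.B n (n + 1) * tw.B m n) a b := by
          simp_rw [Matrix.mul_apply, Finset.mul_sum]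
          exact Finset.sum_comm

lemma firstReturnTime_le_row_sum (hd : 2 ≤ d) {m n p : ℕ} (hmn : m ≤ n) (hnp : n ≤ p) {z : ℝ}
    (hz : z ∈ (tw.iet n).domain) :
    ∃ a, firstReturnTime (tw.iet m).toFun (tw.iet n).domain z ≤ ∑ b, tw.B m p a b := by
  have H := tw.isInduced hd (hmn.trans hnp)
  obtain ⟨w, hw, j, hj, rfl⟩ := H.cover z (tw.domain_antitone hmn hz)
  obtain ⟨a, ha⟩ := (tw.iet p).exists_mem_topI hw
  refine ⟨a, ?_⟩
  rw [← tw.firstReturnTime_eq_row_sum hd (hmn.trans hnp) ha]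
  refine le_trans (Nat.sInf_le ⟨Nat.sub_pos_of_lt hj, ?_⟩) (Nat.sub_le _ j)
  rw [← Function.iterate_add_apply, Nat.sub_add_cancel hj.le, H.map_eq w hw]
  exact tw.domain_antitone hnp (H.mapsTo hw)

lemma abs_sBS_le_supAbsOn (hd : 2 ≤ d) {φ : ℝ → ℝ} (hbd : ∃ K : ℝ, ∀ z ∈ T.domain, |φ z| ≤ K)
    (n : ℕ) {z : ℝ} (hz : z ∈ (tw.iet n).domain) :
    |sBS tw 0 n φ z| ≤ supAbsOn (sBS tw 0 n φ) (tw.iet n).domain := by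
  obtain ⟨K, hK⟩ := hbd
  refine le_csSup ⟨mnorm (tw.B 0 n) * K, ?_⟩ (mem_image_of_mem _ hz)
  rintro _ ⟨w, hw, rfl⟩
  have hw0 := tw.domain_antitone (Nat.zero_le n) hw
  rw [← tw.iet_zero] at hK
  obtain ⟨a, ha⟩ := tw.firstReturnTime_le_row_sum hd (Nat.zero_le n) le_rfl hw
  have hK0 : 0 ≤ K := (abs_nonneg _).trans (hK w hw0)
  refine (IsInduced.abs_birkhoffSum_le (fun _ hx => IET.toFun_mem_domain hx) hK hw0 _).trans
    (mul_le_mul_of_nonneg_right ?_ hK0)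
  rw [mnorm_eq]
  exact_mod_cast ha.trans (Finset.single_le_sum (f := fun a => ∑ b, tw.B 0 n a b)
    (fun _ _ => Nat.zero_le _) (Finset.mem_univ a))

lemma B_acc_pos {l : ℕ} (hl : tw.acc l < tw.acc (l + 1)) (a b : Fin d) :
    0 < tw.B (tw.acc l) (tw.acc (l + 1)) a b :=
  Nat.sInf_mem (Nat.nonempty_of_pos_sInf (lt_of_le_of_lt (Nat.zero_le _) hl)) a b

/-- Return times to intermediate levels between `n_l` and `n_{l+1}` are at most
`‖B(n_l, n_{l+1})‖ - 2`. -/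
lemma exists_returnTime_bound (hd : 2 ≤ d) {l n : ℕ} (hln : tw.acc l ≤ n)
    (hn : n ≤ tw.acc (l + 1)) (hl : tw.acc l < tw.acc (l + 1)) :
    ∃ R : ℕ, (R : ℝ) + 2 = mnorm (tw.B (tw.acc l) (tw.acc (l + 1))) ∧
      ∀ z ∈ (tw.iet n).domain,
        firstReturnTime (tw.iet (tw.acc l)).toFun (tw.iet n).domain z ≤ R := by
  have hrow := row_sum_add_two_le hd (tw.B_acc_pos hl)
  have h2 := hrow ⟨0, by omega⟩
  refine ⟨(∑ a, ∑ b, tw.B (tw.acc l) (tw.acc (l + 1)) a b) - 2, ?_, fun z hz => ?_⟩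
  · rw [mnorm_eq, Nat.cast_sub (by omega)]
    push_cast
    ring
  · obtain ⟨a, ha⟩ := tw.firstReturnTime_le_row_sum hd hln hn hz
    have := hrow a
    omega

lemma exists_acc_lt {q : ℕ} (hq : 0 < tw.acc q) :
    ∃ l < q, tw.acc l < tw.acc q ∧ tw.acc q ≤ tw.acc (l + 1) := by
  have key : ∀ j ≤ q, tw.acc j < tw.acc q →
      ∃ l < q, tw.acc l < tw.acc q ∧ tw.acc q ≤ tw.acc (l + 1) := by
    intro j hj
    induction hj using Nat.decreasingInduction with
    | self => exact fun h => absurd h (lt_irrefl _)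
    | of_succ j hj ih =>
      intro h
      rcases lt_or_ge (tw.acc (j + 1)) (tw.acc q) with h' | h'
      · exact ih h'
      · exact ⟨j, hj, h, h'⟩
  exact key 0 (Nat.zero_le q) hq

/-- The bound on the Birkhoff sums of `S(0, n_q)φ` over the orbit segments of `T(n_q)` which reach
`I(n_k)` and avoid `I(n_{k+1})`. -/
def SegmentBound (φ : ℝ → ℝ) (k q : ℕ) : Prop :=
  ∀ x ∈ (tw.iet (tw.acc q)).domain, ∀ N : ℕ,
    (∀ j < N, (tw.iet (tw.acc q)).toFun^[j] x ∉ (tw.iet (tw.acc (k + 1))).domain) →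
    (∃ j ≤ N, (tw.iet (tw.acc q)).toFun^[j] x ∈ (tw.iet (tw.acc k)).domain) →
    |birkhoffSum (tw.iet (tw.acc q)).toFun (sBS tw 0 (tw.acc q) φ) N x| +
        2 * supAbsOn (sBS tw 0 (tw.acc q) φ) (tw.iet (tw.acc q)).domain ≤
      ∑ l ∈ Finset.Ico q (k + 1), mnorm (tw.B (tw.acc l) (tw.acc (l + 1))) *
        supAbsOn (sBS tw 0 (tw.acc l) φ) (tw.iet (tw.acc l)).domain

variable {φ : ℝ → ℝ} {k : ℕ}

lemma segmentBound_top (hd : 2 ≤ d) (hbd : ∃ K : ℝ, ∀ z ∈ T.domain, |φ z| ≤ K)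
    (hk : tw.acc k < tw.acc (k + 1)) : tw.SegmentBound φ k k := by
  intro x hx N hN _
  obtain ⟨R, hR, hle⟩ := tw.exists_returnTime_bound hd hk.le le_rfl hk
  have H := tw.isInduced hd hk.le
  have hNR : (N : ℝ) ≤ R := by exact_mod_cast H.le_of_avoid hle hx hN
  have h := IsInduced.abs_birkhoffSum_le H.mapsTo_base
    (fun z hz => tw.abs_sBS_le_supAbsOn hd hbd (tw.acc k) hz) hx N
  have h0 := supAbsOn_nonneg (sBS tw 0 (tw.acc k) φ) (tw.iet (tw.acc k)).domain
  rw [Nat.Ico_succ_singleton, Finset.sum_singleton, ← hR]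
  nlinarith

lemma SegmentBound.descend {tw : RVTower d T} (hd : 2 ≤ d)
    (hbd : ∃ K : ℝ, ∀ z ∈ T.domain, |φ z| ≤ K)
    {l q : ℕ} (hlq : l < q) (hqk : q ≤ k) (hacc : tw.acc q ≤ tw.acc k)
    (h1 : tw.acc l < tw.acc q) (h2 : tw.acc q ≤ tw.acc (l + 1))
    (hq : tw.SegmentBound φ k q) : tw.SegmentBound φ k l := by
  intro x hx N havoid hhit
  obtain ⟨R, hR, hle⟩ := tw.exists_returnTime_bound hd h1.le h2 (h1.trans_le h2)
  have H := tw.isInduced hd h1.le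
  have hcomp : ∀ z ∈ (tw.iet (tw.acc q)).domain, sBS tw 0 (tw.acc q) φ z =
      birkhoffSum (tw.iet (tw.acc l)).toFun (sBS tw 0 (tw.acc l) φ)
        (firstReturnTime (tw.iet (tw.acc l)).toFun (tw.iet (tw.acc q)).domain z) z :=
    fun z hz => tw.sBS_comp hd φ (Nat.zero_le _) h1.le hz
  have hsub := tw.domain_antitone hacc
  obtain ⟨x', hx', N', hfrom, hto, hbound⟩ := H.exists_reduction
    (fun z hz => tw.abs_sBS_le_supAbsOn hd hbd (tw.acc l) hz) (supAbsOn_nonneg _ _)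
    (supAbsOn_nonneg (sBS tw 0 (tw.acc q) φ) (tw.iet (tw.acc q)).domain)
    (fun z hz => hcomp z hz ▸ tw.abs_sBS_le_supAbsOn hd hbd (tw.acc q) hz) hle hx
    (hhit.imp fun j hj => ⟨hj.1, hsub hj.2⟩)
  have hsum : birkhoffSum (tw.iet (tw.acc q)).toFun (sBS tw 0 (tw.acc q) φ) N' x' =
      birkhoffSum (tw.iet (tw.acc q)).toFun (fun w => birkhoffSum (tw.iet (tw.acc l)).toFun
        (sBS tw 0 (tw.acc l) φ)
        (firstReturnTime (tw.iet (tw.acc l)).toFun (tw.iet (tw.acc q)).domain w) w) N' x' :=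
    Finset.sum_congr rfl fun j _ => hcomp _ (H.mapsTo.iterate j hx')
  rw [← hsum] at hbound
  have hrec := hq x' hx' N'
    (fun K hK => by
      obtain ⟨j, hj, hjK⟩ := hfrom K hK
      rw [hjK]
      exact havoid j hj)
    (by
      obtain ⟨j, hj, hjk⟩ := hhit
      obtain ⟨K, hK, hjK⟩ := hto j hj (hsub hjk)
      exact ⟨K, hK, hjK ▸ hjk⟩)
  have hsplit := Finset.sum_le_sum_of_subset_of_nonneg
    (f := fun i => mnorm (tw.B (tw.acc i) (tw.acc (i + 1))) *
      supAbsOn (sBS tw 0 (tw.acc i) φ) (tw.iet (tw.acc i)).domain)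
    (show Finset.Ico q (k + 1) ⊆ Finset.Ico (l + 1) (k + 1) from
      Finset.Ico_subset_Ico hlq le_rfl)
    (fun i _ _ => mul_nonneg (mnorm_nonneg _) (supAbsOn_nonneg _ _))
  rw [Finset.sum_eq_sum_Ico_succ_bot (by omega), ← hR]
  linarith

/-- The segment bound holds at some index whose accelerated time is `0`. -/
lemma exists_segmentBound_of_acc_eq_zero (hd : 2 ≤ d)
    (hbd : ∃ K : ℝ, ∀ z ∈ T.domain, |φ z| ≤ K) (hk : tw.acc k < tw.acc (k + 1)) :
    ∃ q ≤ k, tw.acc q = 0 ∧ tw.SegmentBound φ k q := by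
  have key : ∀ q ≤ k, tw.acc q ≤ tw.acc k → tw.SegmentBound φ k q →
      ∃ q ≤ k, tw.acc q = 0 ∧ tw.SegmentBound φ k q := by
    intro q
    induction q using Nat.strong_induction_on with
    | _ q ih =>
      intro hqk hacc hq
      rcases Nat.eq_zero_or_pos (tw.acc q) with h0 | h0
      · exact ⟨q, hqk, h0, hq⟩
      · obtain ⟨l, hlq, h1, h2⟩ := tw.exists_acc_lt h0
        exact ih l hlq (hlq.le.trans hqk) (h1.le.trans hacc)
          (hq.descend hd hbd hlq hqk hacc h1 h2)
  exact key k le_rfl le_rfl (tw.segmentBound_top hd hbd hk)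

end RVTower

/-- **Reduction of Birkhoff sums to special Birkhoff sums.**  If `y` is the point of the
finite orbit `{T^j x : 0 ≤ j < N}` closest to the left endpoint `0` of `I(T)` and `k` is
the largest integer with `y ∈ I(n_k)`, then
`|Σ_{j<N} φ(T^j x)| ≤ Σ_{l=0}^{k} ‖B(n_l, n_{l+1})‖ ‖S(0,n_l)φ‖_{L^∞(I(n_l))}`. -/
theorem birkhoff_reduction {d : ℕ} (hd : 2 ≤ d) (T : IET d) (hT : T.NoConnections)
    (tw : RVTower d T) (φ : ℝ → ℝ) (hbd : ∃ K : ℝ, ∀ z ∈ T.domain, |φ z| ≤ K)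
    (N : ℕ) (hN : 1 ≤ N) (x : ℝ) (hx : x ∈ T.domain)
    (horb : ∀ j < N, T.toFun^[j] x ∈ ⋃ a, T.topI a)
    (y : ℝ) (j₀ : ℕ) (hj₀ : j₀ < N) (hy : y = T.toFun^[j₀] x)
    (hclosest : ∀ j < N, y ≤ T.toFun^[j] x)
    (k : ℕ) (hk₁ : y ∈ (tw.iet (tw.acc k)).domain)
    (hk₂ : y ∉ (tw.iet (tw.acc (k+1))).domain) :
    |∑ j ∈ Finset.range N, φ (T.toFun^[j] x)| ≤
      ∑ l ∈ Finset.range (k+1), mnorm (tw.B (tw.acc l) (tw.acc (l+1))) *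
        sSup ((fun z => |sBS tw 0 (tw.acc l) φ z|) '' (tw.iet (tw.acc l)).domain) := by
  have hacc : tw.acc k < tw.acc (k + 1) :=
    not_le.1 fun hle => hk₂ (tw.domain_antitone hle hk₁)
  obtain ⟨q, hqk, hq0, hq⟩ := tw.exists_segmentBound_of_acc_eq_zero hd hbd hacc
  have hbound := hq x
  rw [hq0, tw.iet_zero] at hbound
  have hdom : ∀ j, T.toFun^[j] x ∈ T.domain := fun j =>
    MapsTo.iterate (fun _ hz => IET.toFun_mem_domain hz) j hx
  have havoid : ∀ j < N, T.toFun^[j] x ∉ (tw.iet (tw.acc (k + 1))).domain := fun j hj hmem =>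
    hk₂ ⟨hk₁.1, (hclosest j hj).trans_lt hmem.2⟩
  have hN' := hbound hx N havoid ⟨j₀, hj₀.le, hy ▸ hk₁⟩
  have hzero : ∀ z ∈ T.domain, sBS tw 0 0 φ z = φ z := fun z hz => by
    rw [← tw.iet_zero] at hz
    rw [sBS, tw.firstReturnTime_self hz, Finset.sum_range_one, Function.iterate_zero, id_eq]
  have hsum : birkhoffSum T.toFun (sBS tw 0 0 φ) N x = ∑ j ∈ Finset.range N, φ (T.toFun^[j] x) :=
    Finset.sum_congr rfl fun j _ => hzero _ (hdom j)
  rw [hsum] at hN'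
  have h0 := supAbsOn_nonneg (sBS tw 0 0 φ) T.domain
  calc |∑ j ∈ Finset.range N, φ (T.toFun^[j] x)|
      ≤ ∑ l ∈ Finset.Ico q (k + 1), mnorm (tw.B (tw.acc l) (tw.acc (l + 1))) *
        supAbsOn (sBS tw 0 (tw.acc l) φ) (tw.iet (tw.acc l)).domain := by linarith
    _ ≤ ∑ l ∈ Finset.range (k + 1), mnorm (tw.B (tw.acc l) (tw.acc (l + 1))) *
        supAbsOn (sBS tw 0 (tw.acc l) φ) (tw.iet (tw.acc l)).domain := by
      rw [Finset.range_eq_Ico]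
      exact Finset.sum_le_sum_of_subset_of_nonneg
        (Finset.Ico_subset_Ico (Nat.zero_le q) le_rfl)
        fun i _ _ => mul_nonneg (mnorm_nonneg _) (supAbsOn_nonneg _ _)

end IETPaper
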